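/- For every ε₂ > 0 and every positive integer N, the infinite word G has a factor of the form u u u' where u' is a prefix of u, |u'| > N, and |uuu'|/|u| > μ − ε₂, where μ = 2 + 1/(λ² − 1) and λ is the unique real zero of x³ − 2x² + x − 1. -/

import Mathlib

/-! Common definitions: the alphabet Σ₃, finite and infinite words, factors,
factor complexity, periods and exponents, morphisms, the morphism γ and its
fixed point G = γ^ω(0). -/

abbrev Sigma3 := Fin 3
abbrev Word := List Sigma3
abbrev InfWord := ℕ → Sigma3

/-- `u` is a factor of the infinite word `w`. -/
def IsFactor (u : Word) (w : InfWord) : Prop :=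
  ∃ i : ℕ, u = (List.range u.length).map (fun j => w (i + j))

/-- The set of finite factors of `w`. -/
def Lang (w : InfWord) : Set Word := {u | IsFactor u w}

/-- Factor complexity: the number of distinct length-`n` factors of `w`. -/
noncomputable def complexity (w : InfWord) (n : ℕ) : ℕ :=
  Set.ncard {u : Word | IsFactor u w ∧ u.length = n}

/-- `v` has period `p` (with `p ≥ 1`). -/
def HasPeriod (v : Word) (p : ℕ) : Prop :=
  1 ≤ p ∧ ∀ i, i + p < v.length → v.getD i 0 = v.getD (i + p) 0

/-- The least period of `v`. -/
noncomputable def minPeriod (v : Word) : ℕ := sInf {p | HasPeriod v p}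

/-- The exponent `|v| / p` of a nonempty finite word `v`, where `p` is its least period. -/
noncomputable def expo (v : Word) : ℝ := (v.length : ℝ) / (minPeriod v : ℝ)

/-- `w` contains no factor of exponent `5/2` or greater. -/
def NoFiveHalves (w : InfWord) : Prop :=
  ∀ u : Word, u ≠ [] → IsFactor u w → expo u < 5 / 2

/-- Apply a morphism (given by the images of the three letters) to a finite word. -/
def applyM (f : Sigma3 → Word) (u : Word) : Word := (u.map f).flatten

/-- The image under `f` of the length-`k` prefix of the infinite word `u`. -/
def imPrefix (f : Sigma3 → Word) (u : InfWord) (k : ℕ) : Word :=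
  applyM f ((List.range k).map u)

/-- The image of an infinite word under a (non-erasing) morphism. -/
def applyMInf (f : Sigma3 → Word) (u : InfWord) : InfWord :=
  fun n => (imPrefix f u (n + 1)).getD n 0

/-- The morphism `γ = [01, 2, 02]`. -/
def gam : Sigma3 → Word := ![[0, 1], [2], [0, 2]]

/-- The fixed point `G = γ^ω(0)` of `γ`, the unique infinite fixed point beginning with 0. -/
def G : InfWord := fun n => ((applyM gam)^[n + 1] [0]).getD n 0

/-- The final segment of `w` starting at position `k`. -/
def shift (w : InfWord) (k : ℕ) : InfWord := fun i => w (i + k)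

/-- The reverse `h^R` of a morphism `h`. -/
def mR (f : Sigma3 → Word) : Sigma3 → Word := fun x => (f x).reverse

theorem applyM_append (f : Sigma3 → Word) (u v : Word) :
    applyM f (u ++ v) = applyM f u ++ applyM f v := by
  simp [applyM]

theorem iterate_applyM_append (f : Sigma3 → Word) (m : ℕ) (u v : Word) :
    (applyM f)^[m] (u ++ v) = (applyM f)^[m] u ++ (applyM f)^[m] v := by
  induction m generalizing u v with
  | zero => rfl
  | succ m ih => simp only [Function.iterate_succ_apply, applyM_append, ih]

theorem length_applyM_gam (w : Word) :
    (applyM gam w).length = 2 * w.count 0 + w.count 1 + 2 * w.count 2 := by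
  induction w with
  | nil => rfl
  | cons x w ih =>
    have h : applyM gam (x :: w) = gam x ++ applyM gam w := rfl
    rw [h, List.length_append, ih]
    fin_cases x <;> simp [gam] <;> ring

theorem length_eq_count (w : Word) : w.length = w.count 0 + w.count 1 + w.count 2 := by
  induction w with
  | nil => rfl
  | cons x w ih => fin_cases x <;> simp [ih] <;> ring

theorem count_applyM_gam (w : Word) :
    (applyM gam w).count 0 = w.count 0 + w.count 2 ∧
      (applyM gam w).count 1 = w.count 0 ∧
      (applyM gam w).count 2 = w.count 1 + w.count 2 := by
  induction w with
  | nil => exact ⟨rfl, rfl, rfl⟩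
  | cons x w ih =>
    have h : applyM gam (x :: w) = gam x ++ applyM gam w := rfl
    rw [h]
    simp only [List.count_append, ih.1, ih.2.1, ih.2.2]
    fin_cases x <;> simp [gam] <;> omega

theorem length_le_length_applyM_gam (w : Word) : w.length ≤ (applyM gam w).length := by
  rw [length_applyM_gam, length_eq_count]
  omega

theorem length_le_length_iterate_applyM_gam (m : ℕ) (w : Word) :
    w.length ≤ ((applyM gam)^[m] w).length := by
  induction m generalizing w with
  | zero => rfl
  | succ m ih => exact (length_le_length_applyM_gam w).trans (ih _)

theorem iterate_succ_applyM_gam_zero (m : ℕ) :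
    (applyM gam)^[m + 1] [0] = (applyM gam)^[m] [0] ++ (applyM gam)^[m] [1] := by
  rw [Function.iterate_succ_apply, ← iterate_applyM_append]
  rfl

theorem lt_length_iterate_applyM_gam_zero (m : ℕ) : m < ((applyM gam)^[m] [0]).length := by
  induction m with
  | zero => simp
  | succ m ih =>
    have h := length_le_length_iterate_applyM_gam m [1]
    rw [iterate_succ_applyM_gam_zero, List.length_append]
    simp only [List.length_singleton] at h
    omega

theorem iterate_applyM_gam_zero_prefix {m n : ℕ} (h : m ≤ n) :
    (applyM gam)^[m] [0] <+: (applyM gam)^[n] [0] := by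
  induction n, h using Nat.le_induction with
  | base => exact List.prefix_rfl
  | succ n _ ih =>
    rw [iterate_succ_applyM_gam_zero]
    exact ih.trans (List.prefix_append _ _)

theorem getElem_iterate_applyM_gam_zero {m n : ℕ} (h : n < ((applyM gam)^[m] [0]).length) :
    ((applyM gam)^[m] [0])[n] = G n := by
  have h' : n < ((applyM gam)^[n + 1] [0]).length :=
    (Nat.lt_succ_self n).trans (lt_length_iterate_applyM_gam_zero (n + 1))
  rw [G, List.getD_eq_getElem _ _ h']
  rcases le_total m (n + 1) with hm | hm
  · exact (iterate_applyM_gam_zero_prefix hm).getElem h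
  · exact ((iterate_applyM_gam_zero_prefix hm).getElem h').symm

theorem isFactor_G_of_infix {w : Word} {m : ℕ} (h : w <:+: (applyM gam)^[m] [0]) :
    IsFactor w G := by
  obtain ⟨s, t, h⟩ := h
  refine ⟨s.length, List.ext_getElem (by simp) fun j hj _ => ?_⟩
  have hlt : s.length + j < ((applyM gam)^[m] [0]).length := by
    rw [← h]
    simp only [List.length_append]
    omega
  rw [List.getElem_map, List.getElem_range, ← getElem_iterate_applyM_gam_zero hlt]
  simp only [← h]
  rw [List.getElem_append_left (by simp; omega), List.getElem_append_right (by omega)]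
  simp

/-- The square of the morphism `γ`. -/
def gamSq (w : Word) : Word := applyM gam (applyM gam w)

theorem gamSq_append (u v : Word) : gamSq (u ++ v) = gamSq u ++ gamSq v := by
  simp only [gamSq, applyM_append]

theorem infix_iterate_gamSq {w : Word} {m : ℕ} (h : w <:+: (applyM gam)^[m] [0]) :
    gamSq w <:+: (applyM gam)^[m + 2] [0] := by
  obtain ⟨s, t, h⟩ := h
  refine ⟨gamSq s, gamSq t, ?_⟩
  rw [← gamSq_append, ← gamSq_append, h, Function.iterate_succ_apply', Function.iterate_succ_apply']
  rfl

theorem count_gamSq (w : Word) :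
    (gamSq w).count 0 = w.count 0 + w.count 1 + 2 * w.count 2 ∧
      (gamSq w).count 1 = w.count 0 + w.count 2 ∧
      (gamSq w).count 2 = w.count 0 + w.count 1 + w.count 2 := by
  obtain ⟨h0, h1, h2⟩ := count_applyM_gam w
  obtain ⟨k0, k1, k2⟩ := count_applyM_gam (applyM gam w)
  simp only [gamSq]
  omega

theorem two_mul_length_le_length_gamSq (w : Word) : 2 * w.length ≤ (gamSq w).length := by
  obtain ⟨h0, h1, h2⟩ := count_gamSq w
  rw [length_eq_count (gamSq w), length_eq_count w]
  omega

theorem gamSq_singleton (x : Sigma3) : ∃ y z, gamSq [x] = 0 :: y :: z := by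
  fin_cases x
  exacts [⟨1, [2], rfl⟩, ⟨2, [], rfl⟩, ⟨1, [0, 2], rfl⟩]

/-- `w` ends in `2` or in `01`. -/
def EndsTwoOrZeroOne (w : Word) : Prop := [2] <:+ w ∨ [0, 1] <:+ w

theorem EndsTwoOrZeroOne.append_left {w : Word} (h : EndsTwoOrZeroOne w) (s : Word) :
    EndsTwoOrZeroOne (s ++ w) :=
  h.imp (fun h => h.trans (List.suffix_append _ _)) (fun h => h.trans (List.suffix_append _ _))

theorem EndsTwoOrZeroOne.gamSq_eq {w : Word} (h : EndsTwoOrZeroOne w) :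
    ∃ t, EndsTwoOrZeroOne t ∧ gamSq w = t ++ [0, 2] := by
  rcases h with ⟨s, rfl⟩ | ⟨s, rfl⟩
  · refine ⟨gamSq s ++ [0, 1], Or.inr (List.suffix_append _ _), ?_⟩
    rw [gamSq_append, List.append_assoc]
    rfl
  · refine ⟨gamSq s ++ [0, 1, 2], Or.inl ⟨gamSq s ++ [0, 1], by simp⟩, ?_⟩
    rw [gamSq_append, List.append_assoc]
    rfl

/-- `u u v` is a repetition in `G`, with `v` a prefix of `u`, that `γ²` extends to both sides:
the images of the last letters of `u` and of the left context `p` share the suffix `02`, and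
all images under `γ²` begin with `0`. The Parikh vector of `v` is an affine function of that
of `u`. -/
structure ExtendableRepetition (u v : Word) : Prop where
  endsWith : EndsTwoOrZeroOne u
  isPrefix : v <+: u
  length_add_le : v.length + 3 ≤ u.length
  isInfix : ∃ (p : Word) (r : Sigma3) (m : ℕ), EndsTwoOrZeroOne p ∧
    p ++ u ++ u ++ v ++ [r] <:+: (applyM gam)^[m] [0]
  count_zero : 5 * v.count 0 + u.count 0 + 1 = 2 * u.count 1 + 3 * u.count 2
  count_one : 5 * v.count 1 + 2 * u.count 1 + 4 = u.count 0 + 2 * u.count 2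
  count_two : 5 * v.count 2 + u.count 2 + 3 = 2 * u.count 0 + u.count 1

theorem extendableRepetition_base :
    ExtendableRepetition [0, 2, 0, 1, 2, 0, 1, 0, 2, 0, 1, 2, 0, 2, 0, 1] [0, 2, 0, 1, 2, 0] where
  endsWith := Or.inr ⟨[0, 2, 0, 1, 2, 0, 1, 0, 2, 0, 1, 2, 0, 2], rfl⟩
  isPrefix := ⟨[1, 0, 2, 0, 1, 2, 0, 2, 0, 1], rfl⟩
  length_add_le := by decide
  isInfix := ⟨[2], 2, 8, Or.inl List.suffix_rfl, ((applyM gam)^[8] [0]).take 39,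
    ((applyM gam)^[8] [0]).drop 79, by decide +kernel⟩
  count_zero := by decide
  count_one := by decide
  count_two := by decide

theorem ExtendableRepetition.extend {u v : Word} (h : ExtendableRepetition u v) :
    ∃ t, gamSq u = t ++ [0, 2] ∧
      ExtendableRepetition ([0, 2] ++ t) ([0, 2] ++ gamSq v ++ [0]) := by
  obtain ⟨t, ht, hut⟩ := h.endsWith.gamSq_eq
  obtain ⟨s, hs⟩ := h.isPrefix
  have hlen := h.length_add_le
  obtain ⟨p, r, m, hp, hm⟩ := h.isInfix
  obtain ⟨q, hq, hpq⟩ := hp.gamSq_eq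
  have hphi : gamSq v ++ gamSq s = t ++ [0, 2] := by rw [← gamSq_append, hs, hut]
  have hslen := two_mul_length_le_length_gamSq s
  have hlen' : (gamSq v).length + 4 ≤ t.length := by
    have h1 := congrArg List.length hphi
    have h2 := congrArg List.length hs
    simp only [List.length_append, List.length_cons, List.length_nil] at h1 h2
    omega
  obtain ⟨c0, c1, c2⟩ := count_gamSq u
  obtain ⟨d0, d1, d2⟩ := count_gamSq v
  rw [hut] at c0 c1 c2
  have e0 := h.count_zero
  have e1 := h.count_one
  have e2 := h.count_two
  refine ⟨t, hut, ht.append_left _, ?_, ?_, ⟨q, ?_⟩, ?_, ?_, ?_⟩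
  · rw [List.append_assoc, List.prefix_append_right_inj]
    refine List.prefix_of_prefix_length_le ?_ (List.prefix_append t [0, 2]) (by simp; omega)
    rw [← hphi, List.prefix_append_right_inj]
    cases s with
    | nil => simp at hslen hs; subst hs; omega
    | cons x s =>
      obtain ⟨y, z, hx⟩ := gamSq_singleton x
      rw [show x :: s = [x] ++ s from rfl, gamSq_append, hx]
      exact ⟨y :: z ++ gamSq s, rfl⟩
  · simp only [List.length_append, List.length_cons, List.length_nil]
    omega
  · obtain ⟨y, z, hr⟩ := gamSq_singleton r
    refine ⟨y, m + 2, hq, List.IsInfix.trans ?_ (infix_iterate_gamSq hm)⟩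
    refine ⟨[], z, ?_⟩
    simp [gamSq_append, hpq, hut, hr]
  all_goals
    simp at c0 c1 c2 ⊢
    omega

/-- A quadratic form on Parikh vectors measuring the distance to the dominant eigendirection of
the incidence matrix of `γ`, which has eigenvalue `lam`. -/
def spreadForm (lam a b c : ℝ) : ℝ :=
  let d := (2 * a + b + 2 * c) - lam * (a + b + c)
  let e := (3 * a + 2 * b + 4 * c) - lam * (2 * a + b + 2 * c)
  lam * e ^ 2 + (lam ^ 2 - 2 * lam) * (d * e) + d ^ 2

theorem lam_mul_spreadForm {lam : ℝ} (hlam : lam ^ 3 - 2 * lam ^ 2 + lam - 1 = 0) (a b c : ℝ) :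
    lam * spreadForm lam (a + c) a (b + c) = spreadForm lam a b c := by
  set d := (2 * a + b + 2 * c) - lam * (a + b + c) with hd
  set e := (3 * a + 2 * b + 4 * c) - lam * (2 * a + b + 2 * c) with he
  set f := (5 * a + 4 * b + 7 * c) - lam * (3 * a + 2 * b + 4 * c) with hf
  have hrec : lam * f = (2 * lam - lam ^ 2) * e - d := by
    rw [hd, he, hf]
    linear_combination (-(2 * a + b + 2 * c)) * hlam
  have h1 : spreadForm lam (a + c) a (b + c) =
      lam * f ^ 2 + (lam ^ 2 - 2 * lam) * (e * f) + e ^ 2 := by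
    simp only [spreadForm, he, hf]
    ring
  have h2 : spreadForm lam a b c = lam * e ^ 2 + (lam ^ 2 - 2 * lam) * (d * e) + d ^ 2 := rfl
  rw [h1, h2]
  linear_combination (lam * f - d) * hrec

theorem one_lt_and_lt_two {lam : ℝ} (hlam : lam ^ 3 - 2 * lam ^ 2 + lam - 1 = 0) :
    1 < lam ∧ lam < 2 := by
  have h : lam * (lam - 1) ^ 2 = 1 := by linear_combination hlam
  have hpos : 0 < lam := by
    by_contra! hneg
    nlinarith [mul_nonneg (neg_nonneg.2 hneg) (sq_nonneg (lam - 1))]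
  constructor
  · by_contra! hle
    nlinarith [mul_nonneg hpos.le (sub_nonneg.2 hle)]
  · by_contra! hle
    nlinarith [mul_nonneg hpos.le (sub_nonneg.2 hle)]

theorem sq_le_two_mul_spreadForm {lam : ℝ} (h1 : 1 < lam) (h2 : lam < 2) (a b c : ℝ) :
    ((2 * a + b + 2 * c) - lam * (a + b + c)) ^ 2 ≤ 2 * spreadForm lam a b c ∧
      ((3 * a + 2 * b + 4 * c) - lam * (2 * a + b + 2 * c)) ^ 2 ≤ 2 * spreadForm lam a b c := by
  simp only [spreadForm]
  set d := (2 * a + b + 2 * c) - lam * (a + b + c)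
  set e := (3 * a + 2 * b + 4 * c) - lam * (2 * a + b + 2 * c)
  have hk : lam * (2 - lam) ^ 2 ≤ 2 := by nlinarith
  constructor
  · nlinarith [mul_nonneg (by linarith : 0 ≤ lam) (sq_nonneg (e + (lam - 2) / 2 * d)),
      mul_nonneg (sub_nonneg.2 hk) (sq_nonneg d)]
  · have hk' : 1 / 2 ≤ lam - (lam ^ 2 - 2 * lam) ^ 2 / 4 := by nlinarith
    nlinarith [sq_nonneg (d + (lam ^ 2 - 2 * lam) / 2 * e),
      mul_nonneg (sub_nonneg.2 hk') (sq_nonneg e)]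

theorem spreadForm_sq_le {lam : ℝ} (hlam : lam ^ 3 - 2 * lam ^ 2 + lam - 1 = 0) (a b c : ℝ) :
    spreadForm lam (a + b + 2 * c) (a + c) (a + b + c) ≤ spreadForm lam a b c := by
  obtain ⟨h1, h2⟩ := one_lt_and_lt_two hlam
  have hle (a b c : ℝ) : spreadForm lam (a + c) a (b + c) ≤ spreadForm lam a b c := by
    have hnonneg : 0 ≤ spreadForm lam (a + c) a (b + c) := by
      have := (sq_nonneg _).trans (sq_le_two_mul_spreadForm h1 h2 (a + c) a (b + c)).1
      linarith
    rw [← lam_mul_spreadForm hlam a b c]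
    nlinarith
  have h := (hle (a + c) a (b + c)).trans (hle a b c)
  rwa [show a + c + (b + c) = a + b + 2 * c by ring, show a + (b + c) = a + b + c by ring] at h

theorem exists_extendableRepetition {lam : ℝ} (hlam : lam ^ 3 - 2 * lam ^ 2 + lam - 1 = 0) :
    ∃ B : ℝ, ∀ k : ℕ, ∃ u v : Word, ExtendableRepetition u v ∧ k ≤ v.length ∧
      spreadForm lam (u.count 0) (u.count 1) (u.count 2) ≤ B := by
  refine ⟨spreadForm lam 7 4 5, fun k => ?_⟩
  induction k with
  | zero => exact ⟨_, _, extendableRepetition_base, Nat.zero_le _, by simp⟩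
  | succ k ih =>
    obtain ⟨u, v, h, hk, hB⟩ := ih
    obtain ⟨t, ht, ht'⟩ := h.extend
    refine ⟨_, _, ht', ?_, ?_⟩
    · have := two_mul_length_le_length_gamSq v
      simp only [List.length_append, List.length_cons, List.length_nil]
      omega
    · refine le_trans (le_of_eq ?_) ((spreadForm_sq_le hlam _ _ _).trans hB)
      obtain ⟨c0, c1, c2⟩ := count_gamSq u
      rw [ht, (List.perm_append_comm (l₁ := t)).count_eq] at c0 c1 c2
      rw [c0, c1, c2]
      push_cast
      rfl

theorem ExtendableRepetition.div_sub_length_le {u v : Word} (h : ExtendableRepetition u v)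
    {lam B : ℝ} (hlam : lam ^ 3 - 2 * lam ^ 2 + lam - 1 = 0) (hB : 0 ≤ B)
    (hu : 2 * spreadForm lam (u.count 0) (u.count 1) (u.count 2) ≤ B ^ 2) :
    (u.length : ℝ) / (lam ^ 2 - 1) - v.length ≤ 2 * B + 2 := by
  obtain ⟨h1, h2⟩ := one_lt_and_lt_two hlam
  obtain ⟨hd, he⟩ := sq_le_two_mul_spreadForm h1 h2 (u.count 0) (u.count 1) (u.count 2)
  have hd := abs_le_of_sq_le_sq' (hd.trans hu) hB
  have he := abs_le_of_sq_le_sq' (he.trans hu) hB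
  have e0 : (5 * v.count 0 + u.count 0 + 1 : ℝ) = 2 * u.count 1 + 3 * u.count 2 :=
    mod_cast h.count_zero
  have e1 : (5 * v.count 1 + 2 * u.count 1 + 4 : ℝ) = u.count 0 + 2 * u.count 2 :=
    mod_cast h.count_one
  have e2 : (5 * v.count 2 + u.count 2 + 3 : ℝ) = 2 * u.count 0 + u.count 1 :=
    mod_cast h.count_two
  have hinv : (u.length : ℝ) / (lam ^ 2 - 1) = u.length * ((2 * lam ^ 2 - lam - 2) / 5) := by
    rw [div_eq_iff (by nlinarith)]
    linear_combination (-(u.length : ℝ) * (2 * lam + 3) / 5) * hlam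
  rw [hinv, length_eq_count u, length_eq_count v]
  push_cast
  set a : ℝ := ((u.count 0 : ℕ) : ℝ)
  set b : ℝ := ((u.count 1 : ℕ) : ℝ)
  set c : ℝ := ((u.count 2 : ℕ) : ℝ)
  set d := (2 * a + b + 2 * c) - lam * (a + b + c) with hd_def
  set e := (3 * a + 2 * b + 4 * c) - lam * (2 * a + b + 2 * c) with he_def
  have key : (a + b + c) * ((2 * lam ^ 2 - lam - 2) / 5) -
      (v.count 0 + v.count 1 + v.count 2) = (8 - 2 * e - (2 * lam - 1) * d) / 5 := by
    rw [hd_def, he_def]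
    linear_combination (-e0 - e1 - e2) / 5
  rw [key]
  nlinarith

/-- For every `ε₂ > 0` and positive integer `N`, the word `G` has a factor `u u u'`
with `u'` a prefix of `u`, `|u'| > N`, and `|uuu'|/|u| > μ - ε₂`, where
`μ = 2 + 1/(λ² - 1)` and `λ` is the real zero of `x³ - 2x² + x - 1`. -/
theorem stmt10 (lam : ℝ) (hlam : lam ^ 3 - 2 * lam ^ 2 + lam - 1 = 0) :
    ∀ ε : ℝ, 0 < ε → ∀ N : ℕ, 0 < N →
      ∃ u u' : Word, u' <+: u ∧ IsFactor (u ++ u ++ u') G ∧ N < u'.length ∧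
        (2 + 1 / (lam ^ 2 - 1)) - ε <
          ((u ++ u ++ u').length : ℝ) / (u.length : ℝ) := by
  intro ε hε N _
  obtain ⟨B, hB⟩ := exists_extendableRepetition hlam
  set R := √(2 * B)
  obtain ⟨k, hk⟩ := exists_nat_gt ((2 * R + 2) / ε)
  obtain ⟨u, v, h, hv, hu⟩ := hB (max k (N + 1))
  obtain ⟨h1, h2⟩ := one_lt_and_lt_two hlam
  have hB0 : 0 ≤ 2 * B := by
    linarith [(sq_nonneg _).trans
      (sq_le_two_mul_spreadForm h1 h2 (u.count 0) (u.count 1) (u.count 2)).1]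
  have hdiff := h.div_sub_length_le hlam (Real.sqrt_nonneg (2 * B))
    (by rw [Real.sq_sqrt hB0]; linarith)
  have hvu := h.length_add_le
  have hku : (k : ℝ) ≤ u.length := by
    have : k ≤ u.length := by omega
    exact_mod_cast this
  have hupos : (0 : ℝ) < u.length := by
    have : 0 < u.length := by omega
    exact_mod_cast this
  refine ⟨u, v, h.isPrefix, ?_, by omega, ?_⟩
  · obtain ⟨p, r, m, _, hm⟩ := h.isInfix
    exact isFactor_G_of_infix (List.IsInfix.trans ⟨p, [r], by simp⟩ hm)
  · rw [lt_div_iff₀ hupos]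
    rw [div_lt_iff₀ hε] at hk
    simp only [List.length_append]
    push_cast
    have hε' := mul_le_mul_of_nonneg_right hku hε.le
    rw [div_eq_mul_one_div] at hdiff
    nlinarith
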